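/- arXiv:1301.5727 — 10 statements merged into one kernel-verified Lean document; each statement's English description precedes it below -/
import Mathlib

section
/- Let H : C(X,E) → C(Y,E) be a pointwise subadditive separating map such that H(1_{e₀})(y) ≠ 0 for all y ∈ Y. Then for every y ∈ Y the set supp(ŷ∘H) consists of exactly one point. -/
open Set

variable {X Y E : Type*} [TopologicalSpace X] [CompactSpace X] [T2Space X]
  [TopologicalSpace Y] [CompactSpace Y] [T2Space Y]
  [NormedRing E] [NormedAlgebra ℂ E] [CompleteSpace E]

/-- The cozero set of a continuous function. -/
def coz (f : C(X, E)) : Set X := {x | f x ≠ 0}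

/-- `H` is separating. -/
def Separating (H : C(X, E) → C(Y, E)) : Prop :=
  ∀ f g : C(X, E), (∀ x : X, ‖f x‖ * ‖g x‖ = 0) → ∀ y : Y, ‖H f y‖ * ‖H g y‖ = 0

/-- `H` is pointwise subadditive. -/
def PointwiseSubadditive (H : C(X, E) → C(Y, E)) : Prop :=
  ∀ f g : C(X, E), ∀ y : Y, ‖H (f + g) y‖ ≤ ‖H f y‖ + ‖H g y‖

/-- `H` is subadditive (with respect to supremum norms). -/
def SubadditiveMap (H : C(X, E) → C(Y, E)) : Prop :=
  ∀ f g : C(X, E), ‖H (f + g)‖ ≤ ‖H f‖ + ‖H g‖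

/-- `H` is strongly subadditive. -/
def StronglySubadditive (H : C(X, E) → C(Y, E)) : Prop :=
  SubadditiveMap H ∧ ∃ M > (0 : ℝ), ∀ f : C(X, E), ∃ ε > (0 : ℝ),
    ∀ g : C(X, E), ‖f - g‖ < ε → ‖H f - H g‖ ≤ M * ‖H (f - g)‖

/-- `U` is a vanishing set for `ŷ ∘ H`. -/
def IsVanishingSet (H : C(X, E) → C(Y, E)) (y : Y) (U : Set X) : Prop :=
  IsOpen U ∧ ∀ f : C(X, E), coz f ⊆ U → H f y = 0

/-- The support of `ŷ ∘ H` : the complement of the union of all vanishing sets. -/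
def suppSet (H : C(X, E) → C(Y, E)) (y : Y) : Set X :=
  (⋃ U ∈ {U : Set X | IsVanishingSet H y U}, U)ᶜ

/-- `H` is strongly pointwise subadditive with respect to a support map `h`. -/
def StronglyPointwiseSubadditive (H : C(X, E) → C(Y, E)) (h : Y → X) : Prop :=
  ∀ y : Y, ∃ M > (0 : ℝ), ∀ c : E, ∃ δ > (0 : ℝ), ∀ f g : C(X, E),
    f (h y) = c → ‖f (h y) - g (h y)‖ < δ →
      ‖H f y - H g y‖ ≤ M * ‖H (f - g) y‖

/-- `H` is detaching. -/
def Detaching (H : C(X, E) → C(Y, E)) : Prop :=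
  ∀ y y' : Y, y ≠ y' → ∃ f g : C(X, E),
    coz f ∩ coz g = ∅ ∧ ‖H f y‖ * ‖H g y'‖ ≠ 0

/-- `H` is norm-bounded. -/
def NormBounded (H : C(X, E) → C(Y, E)) : Prop :=
  ∃ D > (0 : ℝ), ∀ f : C(X, E), ‖H f‖ ≤ D * ‖f‖

/-- `H` is `1_{e₀}`-bounded. -/
def OneBounded (H : C(X, E) → C(Y, E)) : Prop :=
  ∃ D > (0 : ℝ), ∀ e : E,
    ‖H (ContinuousMap.const X e)‖ ≤ D * ‖H (ContinuousMap.const X (1 : E))‖ * ‖e‖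

lemma Separating.map_zero {H : C(X, E) → C(Y, E)} (hsep : Separating H) (y : Y) :
    H 0 y = 0 := by
  simpa using hsep 0 0 (by simp) y

lemma PointwiseSubadditive.map_sum_eq_zero {H : C(X, E) → C(Y, E)}
    (hsub : PointwiseSubadditive H) {y : Y} (h0 : H 0 y = 0) {ι : Type*} (s : Finset ι)
    (f : ι → C(X, E)) (hf : ∀ i ∈ s, H (f i) y = 0) : H (∑ i ∈ s, f i) y = 0 := by
  refine Finset.sum_induction f (fun g => H g y = 0) (fun a b ha hb => ?_) h0 hf
  simpa [ha, hb] using hsub a b y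

lemma mem_suppSet_iff {H : C(X, E) → C(Y, E)} {y : Y} {x : X} :
    x ∈ suppSet H y ↔ ∀ U, IsVanishingSet H y U → x ∉ U := by
  simp [suppSet]

lemma Separating.suppSet_subsingleton {H : C(X, E) → C(Y, E)} (hsep : Separating H) (y : Y) :
    (suppSet H y).Subsingleton := by
  have exists_ne : ∀ {x : X} {U : Set X}, x ∈ suppSet H y → IsOpen U → x ∈ U →
      ∃ f : C(X, E), coz f ⊆ U ∧ H f y ≠ 0 := by
    intro x U hx hU hxU
    by_contra! h
    exact mem_suppSet_iff.1 hx U ⟨hU, h⟩ hxU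
  intro x hx x' hx'
  by_contra hne
  obtain ⟨U, V, hU, hV, hxU, hxV, hUV⟩ := t2_separation hne
  obtain ⟨f, hfU, hf⟩ := exists_ne hx hU hxU
  obtain ⟨g, hgV, hg⟩ := exists_ne hx' hV hxV
  have hfg := hsep f g (fun z => by
    by_contra hz
    obtain ⟨hfz, hgz⟩ := mul_ne_zero_iff.1 hz
    exact Set.disjoint_left.1 hUV (hfU (norm_ne_zero_iff.1 hfz)) (hgV (norm_ne_zero_iff.1 hgz))) y
  exact mul_ne_zero (norm_ne_zero_iff.2 hf) (norm_ne_zero_iff.2 hg) hfg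

lemma suppSet_nonempty {H : C(X, E) → C(Y, E)} (hsep : Separating H)
    (hsub : PointwiseSubadditive H) {y : Y} (hone : H (ContinuousMap.const X (1 : E)) y ≠ 0) :
    (suppSet H y).Nonempty := by
  by_contra hempty
  have hcover : ∀ x : X, ∃ U, IsVanishingSet H y U ∧ x ∈ U := by
    intro x
    by_contra! h
    exact hempty ⟨x, mem_suppSet_iff.2 h⟩
  choose U hU hxU using hcover
  obtain ⟨t, ht⟩ := isCompact_univ.elim_finite_subcover U (fun x => (hU x).1)
    (fun x _ => Set.mem_iUnion.2 ⟨x, hxU x⟩)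
  obtain ⟨ρ, hρ⟩ := PartitionOfUnity.exists_isSubordinate isClosed_univ
    (fun i : t => U i) (fun i => (hU i).1) (fun x hx => by simpa using ht hx)
  let f : t → C(X, E) := fun i => ⟨fun x => (ρ i x : ℂ) • (1 : E), by fun_prop⟩
  have hsum : ∑ i, f i = ContinuousMap.const X (1 : E) := by
    ext x
    have hx : ∑ i, ρ i x = 1 := by
      rw [← finsum_eq_sum_of_fintype]
      exact ρ.sum_eq_one (Set.mem_univ x)
    simp only [ContinuousMap.sum_apply, ContinuousMap.const_apply, f, ContinuousMap.coe_mk]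
    rw [← Finset.sum_smul, ← Complex.ofReal_sum, hx, Complex.ofReal_one, one_smul]
  refine hone (hsum ▸ hsub.map_sum_eq_zero (hsep.map_zero y) Finset.univ f fun i _ => ?_)
  refine (hU i).2 (f i) fun x hx => hρ i (subset_tsupport _ fun h => hx ?_)
  simp [f, h]

/-- for a pointwise subadditive separating `H` with `H 1_{e₀}`
nonvanishing, every support set `supp (ŷ ∘ H)` is a singleton. -/
theorem stmt_2 (H : C(X, E) → C(Y, E))
    (hsep : Separating H)
    (hsub : PointwiseSubadditive H)
    (hone : ∀ y : Y, H (ContinuousMap.const X (1 : E)) y ≠ 0) :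
    ∀ y : Y, ∃ x : X, suppSet H y = {x} := by
  intro y
  exact (Set.exists_eq_singleton_iff_nonempty_subsingleton).2
    ⟨suppSet_nonempty hsep hsub (hone y), hsep.suppSet_subsingleton y⟩
end

section
/- Let H : C(X,E) → C(Y,E) be a pointwise subadditive separating map such that H(1_{e₀})(y) ≠ 0 for all y ∈ Y, with support map h : Y → X. Then for all f ∈ C(X,E), h(coz(Hf)) ⊆ Cl(coz(f)), the closure of the cozero set of f. -/
open Set

variable {X Y E : Type*} [TopologicalSpace X] [CompactSpace X] [T2Space X]
  [TopologicalSpace Y] [CompactSpace Y] [T2Space Y]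
  [NormedRing E] [NormedAlgebra ℂ E] [CompleteSpace E]

/-- `h (coz (H f)) ⊆ Cl (coz f)` for the support map `h`. -/
theorem stmt_3 (H : C(X, E) → C(Y, E))
    (hsep : Separating H)
    (hsub : PointwiseSubadditive H)
    (hone : ∀ y : Y, H (ContinuousMap.const X (1 : E)) y ≠ 0)
    (h : Y → X) (hsupp : ∀ y : Y, suppSet H y = {h y}) :
    ∀ f : C(X, E), h '' (coz (H f)) ⊆ closure (coz f) := by
  rintro f _ ⟨y, hy, rfl⟩
  by_contra hcl
  have hmem : h y ∈ suppSet H y := by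
    rw [hsupp y]
    exact mem_singleton _
  refine hmem (mem_biUnion (x := (closure (coz f))ᶜ) ⟨isClosed_closure.isOpen_compl, ?_⟩ hcl)
  intro g hg
  have hfg : ∀ x : X, ‖f x‖ * ‖g x‖ = 0 := by
    intro x
    by_cases hx : g x = 0
    · simp [hx]
    · have hfx : f x = 0 := by
        by_contra hfx
        exact hg hx (subset_closure hfx)
      simp [hfx]
  rcases mul_eq_zero.mp (hsep f g hfg y) with h0 | h0
  · exact absurd (norm_eq_zero.mp h0) hy
  · exact norm_eq_zero.mp h0
end

section
/- Let H : C(X,E) → C(Y,E) be a pointwise subadditive separating map such that H(1_{e₀})(y) ≠ 0 for all y ∈ Y, with support map h : Y → X. Then for every y ∈ Y, {h(y)} = ⋂ { Cl(coz(f)) : f ∈ C(X,E), ‖Hf(y)‖ ≠ 0 } = supp(ŷ∘H). -/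
open Set

variable {X Y E : Type*} [TopologicalSpace X] [CompactSpace X] [T2Space X]
  [TopologicalSpace Y] [CompactSpace Y] [T2Space Y]
  [NormedRing E] [NormedAlgebra ℂ E] [CompleteSpace E]

omit [CompactSpace X] [T2Space X] [CompactSpace Y] [T2Space Y] [NormedAlgebra ℂ E]
  [CompleteSpace E] in
/-- If `ŷ ∘ H` does not vanish at `f`, then its support lies in the closure of `coz f`. -/
theorem suppSet_subset_closure_coz {H : C(X, E) → C(Y, E)} (hsep : Separating H) {y : Y}
    {f : C(X, E)} (hf : H f y ≠ 0) : suppSet H y ⊆ closure (coz f) := by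
  intro x hx
  by_contra hxf
  refine hx (mem_biUnion (x := (closure (coz f))ᶜ) ⟨isClosed_closure.isOpen_compl, fun g hg ↦ ?_⟩
    hxf)
  have hfg : ∀ z, ‖f z‖ * ‖g z‖ = 0 := fun z ↦ by
    by_cases hz : f z = 0
    · simp [hz]
    · have hgz : g z = 0 := by
        by_contra hgz
        exact hg hgz (subset_closure hz)
      simp [hgz]
  simpa [hf] using hsep f g hfg y

omit [CompleteSpace E] in
/-- A decomposition of the constant function `1` into a part supported in a given neighbourhood
of `x` and a part supported away from `x`. -/
theorem exists_add_eq_const_one {U : Set X} (hU : IsOpen U) {x : X} (hx : x ∈ U) :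
    ∃ f g : C(X, E), coz f ⊆ U ∧ x ∉ closure (coz g) ∧ f + g = ContinuousMap.const X 1 := by
  obtain ⟨V, hV, hxV, hVU⟩ := normal_exists_closure_subset (isClosed_singleton (x := x)) hU
    (singleton_subset_iff.2 hx)
  rw [singleton_subset_iff] at hxV
  obtain ⟨φ, hφ0, hφ1, -⟩ := exists_continuous_zero_one_of_isClosed hU.isClosed_compl
    (isClosed_closure (s := V)) (disjoint_compl_left_iff_subset.2 hVU)
  let f : C(X, E) := ⟨fun z ↦ algebraMap ℂ E (φ z : ℂ), by fun_prop⟩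
  refine ⟨f, ContinuousMap.const X 1 - f, fun z hz ↦ ?_, fun hxg ↦ ?_, by simp⟩
  · by_contra hzU
    exact hz (by simp [f, hφ0 hzU])
  · obtain ⟨z, hzV, hz⟩ := mem_closure_iff.1 hxg V hV hxV
    exact hz (by simp [f, hφ1 (subset_closure hzV)])

/-- `{h y} = ⋂ {Cl (coz f) : ‖H f y‖ ≠ 0} = supp (ŷ ∘ H)`. -/
theorem stmt_4 (H : C(X, E) → C(Y, E))
    (hsep : Separating H)
    (hsub : PointwiseSubadditive H)
    (hone : ∀ y : Y, H (ContinuousMap.const X (1 : E)) y ≠ 0)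
    (h : Y → X) (hsupp : ∀ y : Y, suppSet H y = {h y}) :
    ∀ y : Y,
      ({h y} : Set X) = (⋂ f ∈ {f : C(X, E) | ‖H f y‖ ≠ 0}, closure (coz f)) ∧
      ({h y} : Set X) = suppSet H y := by
  refine fun y ↦ ⟨?_, (hsupp y).symm⟩
  rw [← hsupp y]
  refine Subset.antisymm (subset_iInter₂ fun f hf ↦
    suppSet_subset_closure_coz hsep (norm_ne_zero_iff.1 hf)) fun x hx hxU ↦ ?_
  obtain ⟨U, hU, hxU⟩ := mem_iUnion₂.1 hxU
  obtain ⟨f, g, hfU, hxg, hfg⟩ := exists_add_eq_const_one (E := E) hU.1 hxU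
  refine hxg (mem_iInter₂.1 hx g fun hg ↦ hone y (norm_le_zero_iff.1 ?_))
  simpa [hfg, hU.2 f hfU, hg] using hsub f g y
end

section
/- Let H : C(X,E) → C(Y,E) be a pointwise subadditive separating map such that H(1_{e₀})(y) ≠ 0 for all y ∈ Y, with support map h : Y → X. Suppose there exists M > 0 such that for every f ∈ C(X,E) there exists δ > 0 with ‖Hf(y) − Hg(y)‖ ≤ M‖H(f−g)(y)‖ for all y ∈ Y and all g ∈ C(X,E) satisfying ‖f(h(y)) − g(h(y))‖ < δ (i.e., H is strongly pointwise subadditive with the constants M_y bounded above and, for each f, the numbers δ_{f(h(y)),y} admitting a common positive choice). Then H is strongly subadditive. -/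
open Set

variable {X Y E : Type*} [TopologicalSpace X] [CompactSpace X] [T2Space X]
  [TopologicalSpace Y] [CompactSpace Y] [T2Space Y]
  [NormedRing E] [NormedAlgebra ℂ E] [CompleteSpace E]

/-- strong pointwise subadditivity with uniform constants implies
strong subadditivity. -/
theorem stmt_5 (H : C(X, E) → C(Y, E))
    (hsep : Separating H)
    (hsub : PointwiseSubadditive H)
    (hone : ∀ y : Y, H (ContinuousMap.const X (1 : E)) y ≠ 0)
    (h : Y → X) (hsupp : ∀ y : Y, suppSet H y = {h y})
    (hstrong : ∃ M > (0 : ℝ), ∀ f : C(X, E), ∃ δ > (0 : ℝ),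
      ∀ (y : Y) (g : C(X, E)), ‖f (h y) - g (h y)‖ < δ →
        ‖H f y - H g y‖ ≤ M * ‖H (f - g) y‖) :
    StronglySubadditive H := by
  obtain ⟨M, hM, hstrong⟩ := hstrong
  refine ⟨fun f g => ?_, M, hM, fun f => ?_⟩
  · refine (ContinuousMap.norm_le _ (by positivity)).2 fun y => (hsub f g y).trans ?_
    exact add_le_add ((H f).norm_coe_le_norm y) ((H g).norm_coe_le_norm y)
  · obtain ⟨δ, hδ, hf⟩ := hstrong f
    refine ⟨δ, hδ, fun g hg => ?_⟩
    refine (ContinuousMap.norm_le _ (by positivity)).2 fun y => ?_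
    refine (hf y g (((f - g).norm_coe_le_norm (h y)).trans_lt hg)).trans ?_
    gcongr
    exact (H (f - g)).norm_coe_le_norm y
end

section
/- Let H : C(X,E) → C(Y,E) be a pointwise subadditive separating map such that H(1_{e₀})(y) ≠ 0 for all y ∈ Y, with support map h : Y → X. If f ∈ C(X,E) vanishes on a nonempty open set U ⊆ X and y ∈ Y satisfies h(y) ∈ U, then Hf(y) = 0. -/
open Set

variable {X Y E : Type*} [TopologicalSpace X] [CompactSpace X] [T2Space X]
  [TopologicalSpace Y] [CompactSpace Y] [T2Space Y]
  [NormedRing E] [NormedAlgebra ℂ E] [CompleteSpace E]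

/-- if `f` vanishes on a nonempty open set `U` and `h y ∈ U`,
then `H f y = 0`. -/
theorem stmt_6 (H : C(X, E) → C(Y, E))
    (hsep : Separating H)
    (hsub : PointwiseSubadditive H)
    (hone : ∀ y : Y, H (ContinuousMap.const X (1 : E)) y ≠ 0)
    (h : Y → X) (hsupp : ∀ y : Y, suppSet H y = {h y}) :
    ∀ (f : C(X, E)) (U : Set X) (y : Y), IsOpen U → U.Nonempty →
      (∀ x ∈ U, f x = 0) → h y ∈ U → H f y = 0 := by
  intro f U y hU _ hf hy
  have hnot : ¬ IsVanishingSet H y U := fun hv => by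
    have hmem : h y ∈ suppSet H y := by rw [hsupp y]; exact mem_singleton _
    exact hmem (mem_biUnion (s := {U : Set X | IsVanishingSet H y U}) hv hy)
  obtain ⟨g, hg, hgy⟩ : ∃ g : C(X, E), coz g ⊆ U ∧ H g y ≠ 0 := by
    by_contra! hc
    exact hnot ⟨hU, hc⟩
  have hprod := hsep f g (fun x => by
    by_cases hx : x ∈ U
    · simp [hf x hx]
    · have hgx : g x = 0 := by
        by_contra hne
        exact hx (hg hne)
      simp [hgx]) y
  exact norm_eq_zero.mp ((mul_eq_zero.mp hprod).resolve_right (norm_ne_zero_iff.mpr hgy))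
end

section
/- Let H : C(X,E) → C(Y,E) be a strongly pointwise subadditive separating map such that H(1_{e₀})(y) ≠ 0 for all y ∈ Y, with support map h : Y → X. If f,g ∈ C(X,E) satisfy f = g on an open set U ⊆ X, then Hf = Hg on h⁻¹(U). -/
open Set

variable {X Y E : Type*} [TopologicalSpace X] [CompactSpace X] [T2Space X]
  [TopologicalSpace Y] [CompactSpace Y] [T2Space Y]
  [NormedRing E] [NormedAlgebra ℂ E] [CompleteSpace E]

/-- If `k` vanishes on a neighbourhood of the support point of `ŷ ∘ H`, then `H k y = 0`. -/
theorem Separating.eq_zero_of_eqOn_zero {H : C(X, E) → C(Y, E)} (hsep : Separating H)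
    {y : Y} {x : X} (hx : x ∈ suppSet H y) {k : C(X, E)} {U : Set X} (hU : IsOpen U)
    (hxU : x ∈ U) (hk : ∀ z ∈ U, k z = 0) : H k y = 0 := by
  by_contra hne
  refine hx (mem_biUnion (show IsVanishingSet H y U from ⟨hU, fun f hf => ?_⟩) hxU)
  have hprod : ∀ z : X, ‖k z‖ * ‖f z‖ = 0 := fun z => by
    by_cases hz : f z = 0
    · simp [hz]
    · simp [hk z (hf hz)]
  simpa [hne] using hsep k f hprod y

/-- if `f = g` on an open set `U`, then `H f = H g` on `h ⁻¹' U`. -/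
theorem stmt_7 (H : C(X, E) → C(Y, E))
    (hsep : Separating H)
    (hsub : PointwiseSubadditive H)
    (hone : ∀ y : Y, H (ContinuousMap.const X (1 : E)) y ≠ 0)
    (h : Y → X) (hsupp : ∀ y : Y, suppSet H y = {h y})
    (hstrong : StronglyPointwiseSubadditive H h) :
    ∀ (f g : C(X, E)) (U : Set X), IsOpen U → Set.EqOn (⇑f) (⇑g) U →
      ∀ y ∈ h ⁻¹' U, H f y = H g y := by
  intro f g U hU hfg y hy
  obtain ⟨M, -, hM⟩ := hstrong y
  obtain ⟨δ, hδ, hle⟩ := hM (f (h y))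
  have hzero : H (f - g) y = 0 :=
    hsep.eq_zero_of_eqOn_zero (x := h y) (by rw [hsupp y]; rfl) hU hy
      fun z hz => by simp [hfg hz]
  have hnorm := hle f g rfl (by simpa [hfg hy] using hδ)
  rw [hzero, norm_zero, mul_zero] at hnorm
  exact sub_eq_zero.mp (norm_le_zero_iff.mp hnorm)
end

section
/- Let H : C(X,E) → C(Y,E) be a strongly pointwise subadditive separating map such that H(1_{e₀})(y) ≠ 0 for all y ∈ Y, with support map h : Y → X. Then h is continuous. -/
open Set

variable {X Y E : Type*} [TopologicalSpace X] [CompactSpace X] [T2Space X]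
  [TopologicalSpace Y] [CompactSpace Y] [T2Space Y]
  [NormedRing E] [NormedAlgebra ℂ E] [CompleteSpace E]

/-- An open neighbourhood of a support point carries a function whose image under `H` is nonzero
at `y`. -/
theorem exists_coz_subset_of_mem_suppSet {H : C(X, E) → C(Y, E)} {y : Y} {x : X}
    (hx : x ∈ suppSet H y) {U : Set X} (hU : IsOpen U) (hxU : x ∈ U) :
    ∃ f : C(X, E), coz f ⊆ U ∧ H f y ≠ 0 := by
  by_contra! hcon
  exact hx (mem_iUnion₂.2 ⟨U, ⟨hU, hcon⟩, hxU⟩)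

/-- If `H` is separating and `H f y ≠ 0`, then the support of `y` is contained in the closure of
the cozero set of `f`. -/
theorem Separating.suppSet_subset_closure_coz {H : C(X, E) → C(Y, E)} (hsep : Separating H)
    {f : C(X, E)} {y : Y} (hfy : H f y ≠ 0) : suppSet H y ⊆ closure (coz f) := by
  intro x hx
  by_contra hxf
  obtain ⟨g, hg, hgy⟩ :=
    exists_coz_subset_of_mem_suppSet hx isClosed_closure.isOpen_compl hxf
  refine mul_ne_zero (norm_ne_zero_iff.2 hfy) (norm_ne_zero_iff.2 hgy) (hsep f g (fun z => ?_) y)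
  by_cases hfz : f z = 0
  · simp [hfz]
  · have hgz : g z = 0 := by
      by_contra hgz
      exact hg hgz (subset_closure hfz)
    simp [hgz]


/-- the support map `h` of a strongly pointwise subadditive
separating map is continuous. -/
theorem stmt_8 (H : C(X, E) → C(Y, E))
    (hsep : Separating H)
    (hsub : PointwiseSubadditive H)
    (hone : ∀ y : Y, H (ContinuousMap.const X (1 : E)) y ≠ 0)
    (h : Y → X) (hsupp : ∀ y : Y, suppSet H y = {h y})
    (hstrong : StronglyPointwiseSubadditive H h) :
    Continuous h := by
  refine continuous_iff_continuousAt.2 fun y₀ => ?_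
  have hmem (y : Y) : h y ∈ suppSet H y := by simp [hsupp y]
  refine (closed_nhds_basis (h y₀)).tendsto_right_iff.2 fun C hC => ?_
  obtain ⟨f, hf, hfy⟩ := exists_coz_subset_of_mem_suppSet (hmem y₀) isOpen_interior
    (mem_interior_iff_mem_nhds.2 hC.1)
  filter_upwards [(H f).continuous.continuousAt.eventually_ne hfy] with y hy
  exact closure_minimal (hf.trans interior_subset) hC.2
    (hsep.suppSet_subset_closure_coz hy (hmem y))
end

section
/- Let H : C(X,E) → C(Y,E) be a bijection such that both H and H⁻¹ are separating and strongly pointwise subadditive, with H(1_{e₀})(y) ≠ 0 for all y ∈ Y and H⁻¹(1_{e₀})(x) ≠ 0 for all x ∈ X; let h : Y → X be the support map of H and w : X → Y the support map of H⁻¹. Then h is a homeomorphism of Y onto X, and w = h⁻¹. -/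
open Set

variable {X Y E : Type*} [TopologicalSpace X] [CompactSpace X] [T2Space X]
  [TopologicalSpace Y] [CompactSpace Y] [T2Space Y]
  [NormedRing E] [NormedAlgebra ℂ E] [CompleteSpace E]

/-- A neighbourhood of the support point is not a vanishing set. -/
theorem exists_coz_subset_of_suppSet {H : C(X, E) → C(Y, E)} {y : Y} {x : X}
    (hs : suppSet H y = {x}) {U : Set X} (hU : IsOpen U) (hx : x ∈ U) :
    ∃ g : C(X, E), coz g ⊆ U ∧ H g y ≠ 0 := by
  by_contra! hcon
  have hmem : x ∈ suppSet H y := by rw [hs]; rfl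
  exact hmem (mem_biUnion (show U ∈ {U : Set X | IsVanishingSet H y U} from ⟨hU, hcon⟩) hx)

/-- A separating map sends functions vanishing near the support point to functions vanishing
at the base point. -/
theorem Separating.apply_eq_zero {H : C(X, E) → C(Y, E)} (hsep : Separating H) {y : Y} {x : X}
    (hs : suppSet H y = {x}) {U : Set X} (hU : IsOpen U) (hx : x ∈ U) {f : C(X, E)}
    (hf : ∀ z ∈ U, f z = 0) : H f y = 0 := by
  obtain ⟨g, hgU, hg⟩ := exists_coz_subset_of_suppSet hs hU hx
  have hfg : ∀ z, ‖f z‖ * ‖g z‖ = 0 := fun z => by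
    by_cases hz : g z = 0
    · simp [hz]
    · simp [hf z (hgU hz)]
  simpa [hg] using hsep f g hfg y

theorem Separating.continuous_supportMap {H : C(X, E) → C(Y, E)} (hsep : Separating H)
    {h : Y → X} (hs : ∀ y, suppSet H y = {h y}) : Continuous h := by
  refine continuous_iff_continuousAt.2 fun y U hU => Filter.mem_map.2 ?_
  obtain ⟨C, hC, hCc, hCU⟩ := exists_mem_nhds_isClosed_subset hU
  obtain ⟨f, hfC, hf⟩ := exists_coz_subset_of_suppSet (hs y) isOpen_interior
    (mem_interior_iff_mem_nhds.2 hC)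
  filter_upwards [(H f).continuous.continuousAt.eventually_ne hf] with z hz
  by_contra hzU
  refine hz (hsep.apply_eq_zero (hs z) hCc.isOpen_compl (fun hzC => hzU (hCU hzC)) ?_)
  intro t ht
  by_contra hft
  exact ht (interior_subset (hfC hft))

theorem Separating.leftInverse_supportMap [Nontrivial E] {H : C(X, E) → C(Y, E)}
    {H' : C(Y, E) → C(X, E)} (hri : Function.RightInverse H' H)
    (hsep : Separating H) (hsep' : Separating H')
    {h : Y → X} (hs : ∀ y, suppSet H y = {h y}) {w : X → Y} (hs' : ∀ x, suppSet H' x = {w x}) :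
    Function.LeftInverse w h := by
  intro y
  by_contra hne
  obtain ⟨V, W, hV, hW, hwV, hyW, hVW⟩ := t2_separation hne
  obtain ⟨g, hgV, hg⟩ := exists_coz_subset_of_suppSet (hs' (h y)) hV hwV
  obtain ⟨φ, hφ0, hφ1, -⟩ := exists_continuous_zero_one_of_isClosed hW.isClosed_compl
    (isClosed_singleton (x := y)) (by simpa using hyW)
  let k : C(Y, E) := ⟨fun z => ((φ z : ℝ) : ℂ) • (1 : E), by fun_prop⟩
  have hgk : ∀ z, ‖k z‖ * ‖g z‖ = 0 := fun z => by
    by_cases hz : g z = 0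
    · simp [hz]
    · have : φ z = 0 := hφ0 (disjoint_left.1 hVW (hgV hz))
      simp [k, this]
  have hk : H (H' k) y = 0 := by
    refine hsep.apply_eq_zero (hs y) (U := {x | H' g x ≠ 0})
      (isOpen_ne_fun (H' g).continuous continuous_const) hg fun x hx => ?_
    have hx' : H' g x ≠ 0 := hx
    simpa [hx'] using hsep' k g hgk x
  have hφy : φ y = 1 := hφ1 rfl
  rw [hri k] at hk
  simp [k, hφy] at hk

/-- for a biseparating bijection `H` with `H` and `H⁻¹` strongly
pointwise subadditive, the support map `h` is a homeomorphism and the support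
map `w` of `H⁻¹` equals `h⁻¹`. -/
theorem stmt_12 (H : C(X, E) → C(Y, E)) (H' : C(Y, E) → C(X, E))
    (hli : Function.LeftInverse H' H) (hri : Function.RightInverse H' H)
    (hsep : Separating H) (hsep' : Separating H')
    (hsub : PointwiseSubadditive H) (hsub' : PointwiseSubadditive H')
    (hone : ∀ y : Y, H (ContinuousMap.const X (1 : E)) y ≠ 0)
    (hone' : ∀ x : X, H' (ContinuousMap.const Y (1 : E)) x ≠ 0)
    (h : Y → X) (hsupp : ∀ y : Y, suppSet H y = {h y})
    (w : X → Y) (hsupp' : ∀ x : X, suppSet H' x = {w x})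
    (hstrong : StronglyPointwiseSubadditive H h)
    (hstrong' : StronglyPointwiseSubadditive H' w) :
    IsHomeomorph h ∧ Function.LeftInverse w h ∧ Function.RightInverse w h := by
  have hc := hsep.continuous_supportMap hsupp
  have hc' := hsep'.continuous_supportMap hsupp'
  have hl : Function.LeftInverse w h := fun y => by
    have : Nontrivial E := ⟨⟨_, _, hone y⟩⟩
    exact hsep.leftInverse_supportMap hri hsep' hsupp hsupp' y
  have hr : Function.RightInverse w h := fun x => by
    have : Nontrivial E := ⟨⟨_, _, hone' x⟩⟩
    exact hsep'.leftInverse_supportMap hli hsep hsupp' hsupp x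
  exact ⟨isHomeomorph_iff_exists_inverse.2 ⟨hc, w, hl, hr, hc'⟩, hl, hr⟩
end

section
/- Let H : C(X,E) → C(Y,E) be a composition map, i.e., there is a continuous map p : Y → X such that Hf(y) = H(1_{f(p(y))})(y) for all f ∈ C(X,E) and y ∈ Y. If H is 1_{e₀}-bounded, then H is norm-bounded. -/
open Set

variable {X Y E : Type*} [TopologicalSpace X] [CompactSpace X] [T2Space X]
  [TopologicalSpace Y] [CompactSpace Y] [T2Space Y]
  [NormedRing E] [NormedAlgebra ℂ E] [CompleteSpace E]

/-- a `1_{e₀}`-bounded composition map is norm-bounded. -/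
theorem stmt_14 (H : C(X, E) → C(Y, E)) (p : C(Y, X))
    (hcomp : ∀ (f : C(X, E)) (y : Y),
      H f y = H (ContinuousMap.const X (f (p y))) y)
    (hb : OneBounded H) :
    NormBounded H := by
  obtain ⟨D, hD, hbound⟩ := hb
  refine ⟨D * ‖H (ContinuousMap.const X (1 : E))‖ + 1, by positivity, fun f => ?_⟩
  refine (ContinuousMap.norm_le _ (by positivity)).2 fun y => ?_
  calc ‖H f y‖ = ‖H (ContinuousMap.const X (f (p y))) y‖ := by rw [← hcomp]
    _ ≤ ‖H (ContinuousMap.const X (f (p y)))‖ := ContinuousMap.norm_coe_le_norm _ y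
    _ ≤ D * ‖H (ContinuousMap.const X (1 : E))‖ * ‖f (p y)‖ := hbound _
    _ ≤ (D * ‖H (ContinuousMap.const X (1 : E))‖ + 1) * ‖f‖ := by
      gcongr
      · linarith
      · exact ContinuousMap.norm_coe_le_norm f (p y)
end

section
/- Let H : C(X,E) → C(Y,E) be a separating, strongly pointwise subadditive map with H(1_{e₀})(y) ≠ 0 for all y ∈ Y and support map h : Y → X. If y belongs to the continuity set Y_c of H, then Hf(y) = H(1_{f(h(y))})(y) for all f ∈ C(X,E). -/
open Set

variable {X Y E : Type*} [TopologicalSpace X] [CompactSpace X] [T2Space X]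
  [TopologicalSpace Y] [CompactSpace Y] [T2Space Y]
  [NormedRing E] [NormedAlgebra ℂ E] [CompleteSpace E]

omit [CompactSpace X] [T2Space X] [CompactSpace Y] [T2Space Y] [NormedAlgebra ℂ E]
  [CompleteSpace E] in
/-- If `g` vanishes near the support point of `ŷ ∘ H`, then `H g y = 0`. -/
theorem Separating.apply_eq_zero_of_eqOn_nhds {H : C(X, E) → C(Y, E)} (hsep : Separating H)
    {y : Y} {x : X} (hx : x ∈ suppSet H y) {g : C(X, E)} {U : Set X} (hU : IsOpen U) (hxU : x ∈ U)
    (hg : ∀ z ∈ U, g z = 0) : H g y = 0 := by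
  have hnot : ¬ IsVanishingSet H y U := fun hv => hx (mem_biUnion (show U ∈ {U | _} from hv) hxU)
  simp only [IsVanishingSet, hU, true_and] at hnot
  push Not at hnot
  obtain ⟨f, hfU, hf⟩ := hnot
  have hfg : ∀ z, ‖g z‖ * ‖f z‖ = 0 := by
    intro z
    by_cases hz : f z = 0
    · simp [hz]
    · simp [hg z (hfU hz)]
  have := hsep g f hfg y
  simpa [hf] using this

omit [T2Space X] [CompleteSpace E] in
/-- A continuous function vanishing at `x` is a uniform limit of continuous functions
vanishing near `x`. -/
theorem exists_dist_le_eqOn_nhds_zero (g : C(X, E)) {x : X} (hgx : g x = 0) {ε : ℝ} (hε : 0 < ε) :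
    ∃ k : C(X, E), dist g k ≤ ε ∧ ∃ U : Set X, IsOpen U ∧ x ∈ U ∧ ∀ z ∈ U, k z = 0 := by
  have hpos : ∀ z, 0 < max ε ‖g z‖ := fun z => lt_max_of_lt_left hε
  have hcont : Continuous fun z => g z - ((ε / max ε ‖g z‖ : ℝ) : ℂ) • g z := by
    have hq : Continuous fun z => ε / max ε ‖g z‖ :=
      continuous_const.div (by fun_prop) fun z => (hpos z).ne'
    exact g.continuous.sub ((Complex.continuous_ofReal.comp hq).smul g.continuous)
  refine ⟨⟨_, hcont⟩, ?_, {z | ‖g z‖ < ε}, isOpen_lt (by fun_prop) continuous_const,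
    by simpa [hgx] using hε, fun z hz => ?_⟩
  · refine (ContinuousMap.dist_le hε.le).2 fun z => ?_
    change dist (g z) (g z - ((ε / max ε ‖g z‖ : ℝ) : ℂ) • g z) ≤ ε
    rw [dist_eq_norm, sub_sub_cancel, norm_smul, Complex.norm_real,
      Real.norm_of_nonneg (div_nonneg hε.le (hpos z).le), div_mul_eq_mul_div, div_le_iff₀ (hpos z)]
    exact mul_le_mul_of_nonneg_left (le_max_right _ _) hε.le
  · have hz' : max ε ‖g z‖ = ε := max_eq_left (le_of_lt hz)
    simp [hz', hε.ne']

/-- on the continuity set, `H f y = H (1_{f (h y)}) y`. -/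
theorem stmt_15 (H : C(X, E) → C(Y, E))
    (hsep : Separating H)
    (hsub : PointwiseSubadditive H)
    (hone : ∀ y : Y, H (ContinuousMap.const X (1 : E)) y ≠ 0)
    (h : Y → X) (hsupp : ∀ y : Y, suppSet H y = {h y})
    (hstrong : StronglyPointwiseSubadditive H h)
    (y : Y) (hy : Continuous fun f : C(X, E) => H f y) :
    ∀ f : C(X, E), H f y = H (ContinuousMap.const X (f (h y))) y := by
  intro f
  have hmem : h y ∈ suppSet H y := by simp [hsupp y]
  obtain ⟨M, -, hM⟩ := hstrong y
  obtain ⟨δ, hδ, hMδ⟩ := hM (f (h y))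
  set c := ContinuousMap.const X (f (h y)) with hc
  have hclosed : IsClosed {g : C(X, E) | H g y = 0} := isClosed_eq hy continuous_const
  have hzero : H (f - c) y = 0 := by
    refine hclosed.closure_subset (Metric.mem_closure_iff.2 fun ε hε => ?_)
    obtain ⟨k, hk, U, hU, hxU, hkU⟩ :=
      exists_dist_le_eqOn_nhds_zero (f - c) (x := h y) (by simp [hc]) (half_pos hε)
    exact ⟨k, hsep.apply_eq_zero_of_eqOn_nhds hmem hU hxU hkU, by linarith⟩
  have hle := hMδ f c rfl (by simpa [hc] using hδ)
  rw [hzero, norm_zero, mul_zero] at hle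
  exact sub_eq_zero.1 (norm_le_zero_iff.1 hle)
end
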